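/- arXiv:1509.02577 — 4 statements merged into one kernel-verified Lean document; each statement's English description precedes it below -/
import Mathlib

section
/- Let β > 0 and let H be a 3-graph on n vertices with a partition V(H) = X ∪ Y. Suppose there are at most β·C(|X|,2)·C(|Y|,2) copies of K₄⁻ in H with exactly two vertices in X and two vertices in Y. Then (|Y| − 1)·e(XXY) + (|X| − 1)·e(XYY) ≤ 2(1 + β)·C(|X|,2)·C(|Y|,2). -/
open Finset

/-- `H` is the edge set of a 3-uniform hypergraph (3-graph) on `Fin n`. -/
def Is3Graph (n : ℕ) (H : Finset (Finset (Fin n))) : Prop :=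
  ∀ e ∈ H, e.card = 3

/-- `degOn H x y U` : number of `z ∈ U` with `{x,y,z} ∈ H`, i.e. `deg_H(xy, U)`. -/
def degOn {n : ℕ} (H : Finset (Finset (Fin n))) (x y : Fin n) (U : Finset (Fin n)) : ℕ :=
  (U.filter fun z => ({x, y, z} : Finset (Fin n)) ∈ H).card

/-- The minimum codegree `δ₂(H)` is at least `t`. -/
def CodegLB {n : ℕ} (H : Finset (Finset (Fin n))) (t : ℝ) : Prop :=
  ∀ x y : Fin n, x ≠ y → t ≤ (degOn H x y Finset.univ : ℝ)

/-- `S` spans a copy of `K₄⁻` in `H`: it has 4 vertices and at least 3 of its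
four 3-subsets are edges. -/
def SpansK4m {n : ℕ} (H : Finset (Finset (Fin n))) (S : Finset (Fin n)) : Prop :=
  S.card = 4 ∧ 3 ≤ ((S.powersetCard 3).filter (· ∈ H)).card

/-- `S` spans a copy of `K₄³` (the complete 3-graph on 4 vertices) in `H`. -/
def SpansK43 {n : ℕ} (H : Finset (Finset (Fin n))) (S : Finset (Fin n)) : Prop :=
  S.card = 4 ∧ ((S.powersetCard 3).filter (· ∈ H)).card = 4

/-- The induced subgraph `H[X]` contains a `K₄⁻`-factor. -/
def HasK4mFactorOn {n : ℕ} (H : Finset (Finset (Fin n))) (X : Finset (Fin n)) : Prop :=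
  ∃ P : Finset (Finset (Fin n)),
    (∀ S ∈ P, SpansK4m H S) ∧
    (∀ S ∈ P, ∀ T ∈ P, S ≠ T → Disjoint S T) ∧
    P.biUnion id = X

/-- `S` is an `(x,y)`-connector of length `c` in `H`. -/
def IsConnector {n : ℕ} (H : Finset (Finset (Fin n))) (c : ℕ) (x y : Fin n)
    (S : Finset (Fin n)) : Prop :=
  x ∉ S ∧ y ∉ S ∧ S.card = 4 * c - 1 ∧
    HasK4mFactorOn H (insert x S) ∧ HasK4mFactorOn H (insert y S)

/-- `x` and `y` are `(c,η)`-close in `H` (a 3-graph on `n` vertices). -/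
def Close {n : ℕ} (H : Finset (Finset (Fin n))) (c : ℕ) (η : ℝ) (x y : Fin n) : Prop :=
  η * (n : ℝ) ^ (4 * c - 1) ≤ ({S : Finset (Fin n) | IsConnector H c x y S}.ncard : ℝ)

/-- `U` is `(c,η)`-closed in `H`. -/
def ClosedOn {n : ℕ} (H : Finset (Finset (Fin n))) (c : ℕ) (η : ℝ)
    (U : Finset (Fin n)) : Prop :=
  ∀ x ∈ U, ∀ y ∈ U, x ≠ y → Close H c η x y

/-- The number of `(X,Y)`-bridges `(x,y,S)` of length `c` in `H`. -/
noncomputable def BridgeCount {n : ℕ} (H : Finset (Finset (Fin n))) (c : ℕ)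
    (X Y : Finset (Fin n)) : ℕ :=
  {t : Fin n × Fin n × Finset (Fin n) |
    t.1 ∈ X ∧ t.2.1 ∈ Y ∧ IsConnector H c t.1 t.2.1 t.2.2}.ncard

/-- The 3-graph `𝓑[A,B]`: all triples in `A ∪ B` containing an odd number of
vertices of `A`. -/
def BGraph {n : ℕ} (A B : Finset (Fin n)) : Finset (Finset (Fin n)) :=
  ((A ∪ B).powersetCard 3).filter fun e => (e ∩ A).card % 2 = 1

/-- `H` (a 3-graph on `n` vertices) is `γ`-extremal. -/
def IsExtremal {n : ℕ} (H : Finset (Finset (Fin n))) (γ : ℝ) : Prop :=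
  ∃ A B : Finset (Fin n), Disjoint A B ∧ A ∪ B = Finset.univ ∧
    A.card = n / 2 ∧ B.card = n - n / 2 ∧
    ((BGraph A B \ H).card : ℝ) ≤ γ * (n : ℝ) ^ 3

/-- The number of `V₁V₂V₃`-edges of `H`. -/
def eCount {n : ℕ} (H : Finset (Finset (Fin n))) (A B C : Finset (Fin n)) : ℕ :=
  (H.filter fun e => ∃ a ∈ A, ∃ b ∈ B, ∃ c ∈ C, e = {a, b, c}).card

/-- `Ñ_{c,η}(x)` : the set of vertices `(c,η)`-close to `x` in `H`. -/
def Ntilde {n : ℕ} (H : Finset (Finset (Fin n))) (c : ℕ) (η : ℝ) (x : Fin n) :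
    Set (Fin n) :=
  {y | y ≠ x ∧ Close H c η x y}

/-- The triple `{x,x',y}` is `(ρ,X,Y)`-typical. -/
def TypicalTriple {n : ℕ} (H : Finset (Finset (Fin n))) (ρ : ℝ) (X Y : Finset (Fin n))
    (x x' y : Fin n) : Prop :=
  (Y.card : ℝ) - ρ * n ≤ (degOn H x x' Y : ℝ) ∧
  (((X.filter fun z => ({x, y, z} : Finset (Fin n)) ∈ H ∧
      ({x', y, z} : Finset (Fin n)) ∈ H).card : ℝ) ≤ ρ * n) ∧
  (X.card : ℝ) - ρ * n ≤ (degOn H x y X : ℝ) + (degOn H x' y X : ℝ)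

/-- `Q` spans an `(X,Y)`-bridge of length 1, i.e. `Q = {a,b} ∪ S` for some
`(X,Y)`-bridge `(a,b,S)` of length 1. -/
def SpansBridge1 {n : ℕ} (H : Finset (Finset (Fin n))) (X Y Q : Finset (Fin n)) : Prop :=
  ∃ a ∈ X, ∃ b ∈ Y, ∃ S : Finset (Fin n), IsConnector H 1 a b S ∧
    Q = insert a (insert b S)


theorem aux_ext {n : ℕ} (X Y : Finset (Fin n)) (hd : Disjoint X Y) (e : Finset (Fin n))
    (hX : (e ∩ X).card = 2) (hY : (e ∩ Y).card = 1) :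
    Y.card ≤ ((univ : Finset (Finset (Fin n))).filter
      (fun S => ((S ∩ X).card = 2 ∧ (S ∩ Y).card = 2) ∧ e ⊆ S)).card + 1 := by
  have h1 : (Y \ e).card + (e ∩ Y).card = Y.card := by
    rw [inter_comm]; exact card_sdiff_add_card_inter Y e
  have h2 : (Y \ e).card ≤ ((univ : Finset (Finset (Fin n))).filter
      (fun S => ((S ∩ X).card = 2 ∧ (S ∩ Y).card = 2) ∧ e ⊆ S)).card := by
    apply card_le_card_of_injOn (fun y => insert y e)
    · intro y hy
      have hy' : y ∈ Y ∧ y ∉ e := by simpa using hy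
      have hyX : y ∉ X := fun h => (disjoint_left.mp hd h) hy'.1
      simp only [coe_filter, mem_univ, true_and, Set.mem_setOf_eq]
      refine ⟨⟨?_, ?_⟩, subset_insert _ _⟩
      · rw [insert_inter_of_notMem hyX, hX]
      · rw [insert_inter_of_mem hy'.1, card_insert_of_notMem (by simp [hy'.2]), hY]
    · intro a ha b hb hab
      have ha' : a ∈ Y ∧ a ∉ e := by simpa using ha
      have : a ∈ insert b e := by
        have : insert a e = insert b e := hab
        rw [← this]; simp
      rcases mem_insert.mp this with h | h
      · exact h
      · exact absurd h ha'.2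
  omega

theorem aux_card {n : ℕ} (X Y : Finset (Fin n)) (hd : Disjoint X Y)
    (hp : X ∪ Y = Finset.univ) :
    ((univ : Finset (Finset (Fin n))).filter
      (fun S => (S ∩ X).card = 2 ∧ (S ∩ Y).card = 2)).card ≤
      X.card.choose 2 * Y.card.choose 2 := by
  rw [← card_powersetCard, ← card_powersetCard, ← card_product]
  apply card_le_card_of_injOn (fun S => (S ∩ X, S ∩ Y))
  · intro S hS
    have hS' : (S ∩ X).card = 2 ∧ (S ∩ Y).card = 2 := by simpa using hS
    simp [mem_powersetCard, hS'.1, hS'.2]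
  · intro S _ T _ h
    have h1 : S ∩ X = T ∩ X := congrArg Prod.fst h
    have h2 : S ∩ Y = T ∩ Y := congrArg Prod.snd h
    calc S = S ∩ (X ∪ Y) := by rw [hp, inter_univ]
      _ = T ∩ (X ∪ Y) := by rw [inter_union_distrib_left, h1, h2, ← inter_union_distrib_left]
      _ = T := by rw [hp, inter_univ]

theorem aux_edge {n : ℕ} (X Y : Finset (Fin n)) (hd : Disjoint X Y) (a b c : Fin n)
    (ha : a ∈ X) (hb : b ∈ X) (hc : c ∈ Y) (h3 : ({a, b, c} : Finset (Fin n)).card = 3) :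
    (({a, b, c} : Finset (Fin n)) ∩ X).card = 2 ∧
    (({a, b, c} : Finset (Fin n)) ∩ Y).card = 1 := by
  have hab : a ≠ b := by
    rintro rfl
    have := card_le_two (a := a) (b := c)
    simp at h3; omega
  have ha' : a ∉ Y := disjoint_left.mp hd ha
  have hb' : b ∉ Y := disjoint_left.mp hd hb
  have hc' : c ∉ X := disjoint_right.mp hd hc
  have e1 : ({a, b, c} : Finset (Fin n)) ∩ X = {a, b} := by
    ext z; simp only [mem_inter, mem_insert, mem_singleton]; grind
  have e2 : ({a, b, c} : Finset (Fin n)) ∩ Y = {c} := by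
    ext z; simp only [mem_inter, mem_insert, mem_singleton]; grind
  rw [e1, e2]
  exact ⟨card_pair hab, card_singleton c⟩

/-- few `K₄⁻`-copies balanced between `X` and `Y` bound edge counts. -/
theorem stmt_7 {n : ℕ} (β : ℝ) (hβ : 0 < β) (H : Finset (Finset (Fin n)))
    (h3 : Is3Graph n H) (X Y : Finset (Fin n)) (hd : Disjoint X Y)
    (hp : X ∪ Y = Finset.univ)
    (hcopies : ({S : Finset (Fin n) | SpansK4m H S ∧
        (S ∩ X).card = 2 ∧ (S ∩ Y).card = 2}.ncard : ℝ) ≤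
      β * (X.card.choose 2 : ℝ) * (Y.card.choose 2 : ℝ)) :
    ((Y.card : ℝ) - 1) * (eCount H X X Y : ℝ) +
      ((X.card : ℝ) - 1) * (eCount H X Y Y : ℝ) ≤
      2 * (1 + β) * (X.card.choose 2 : ℝ) * (Y.card.choose 2 : ℝ) := by
  classical
  set Q := (univ : Finset (Finset (Fin n))).filter
      (fun S => (S ∩ X).card = 2 ∧ (S ∩ Y).card = 2) with hQ
  set K := Q.filter (fun S => SpansK4m H S) with hK
  have hKc : {S : Finset (Fin n) | SpansK4m H S ∧
        (S ∩ X).card = 2 ∧ (S ∩ Y).card = 2}.ncard = K.card := by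
    rw [← Set.ncard_coe_finset]
    congr 1
    ext S
    simp [hK, hQ, and_comm]
  rw [hKc] at hcopies
  have hQc : Q.card ≤ X.card.choose 2 * Y.card.choose 2 := aux_card X Y hd hp
  have hS4 : ∀ S ∈ Q, S.card = 4 := by
    intro S hS
    have hS' : (S ∩ X).card = 2 ∧ (S ∩ Y).card = 2 := by simpa [hQ] using hS
    have : S = (S ∩ X) ∪ (S ∩ Y) := by rw [← inter_union_distrib_left, hp, inter_univ]
    rw [this, card_union_of_disjoint, hS'.1, hS'.2]
    exact hd.mono inter_subset_right inter_subset_right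
  -- upper bound
  have hub : ∑ S ∈ Q, (H.filter (fun e => e ⊆ S)).card ≤ 2 * Q.card + 2 * K.card := by
    have : ∀ S ∈ Q, (H.filter (fun e => e ⊆ S)).card ≤ 2 + 2 * (if SpansK4m H S then 1 else 0) := by
      intro S hS
      have heq : H.filter (fun e => e ⊆ S) = (S.powersetCard 3).filter (· ∈ H) := by
        ext e
        simp only [mem_filter, mem_powersetCard]
        constructor
        · rintro ⟨h, h'⟩; exact ⟨⟨h', h3 e h⟩, h⟩
        · rintro ⟨⟨h, _⟩, h'⟩; exact ⟨h', h⟩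
      rw [heq]
      have h4 : ((S.powersetCard 3).filter (· ∈ H)).card ≤ 4 := by
        refine (card_filter_le _ _).trans ?_
        rw [card_powersetCard, hS4 S hS]; decide
      split_ifs with hs
      · omega
      · have : ¬ 3 ≤ ((S.powersetCard 3).filter (· ∈ H)).card := fun h => hs ⟨hS4 S hS, h⟩
        omega
    refine (sum_le_sum this).trans ?_
    rw [sum_add_distrib, ← mul_sum, ← card_filter, sum_const, smul_eq_mul, mul_comm]
  have hdc : ∑ S ∈ Q, (H.filter (fun e => e ⊆ S)).card
      = ∑ e ∈ H, (Q.filter (fun S => e ⊆ S)).card := by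
    simp only [card_filter]
    exact sum_comm
  set E1 := H.filter (fun e => ∃ a ∈ X, ∃ b ∈ X, ∃ c ∈ Y, e = {a, b, c}) with hE1
  set E2 := H.filter (fun e => ∃ a ∈ X, ∃ b ∈ Y, ∃ c ∈ Y, e = {a, b, c}) with hE2
  have c1 : eCount H X X Y = E1.card := by
    unfold eCount; rw [hE1]
  have c2 : eCount H X Y Y = E2.card := by
    unfold eCount; rw [hE2]
  have p1 : ∀ e ∈ E1, (e ∩ X).card = 2 ∧ (e ∩ Y).card = 1 := by
    intro e he
    obtain ⟨heH, a, ha, b, hb, c, hc, rfl⟩ := mem_filter.mp he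
    exact aux_edge X Y hd a b c ha hb hc (h3 _ heH)
  have p2 : ∀ e ∈ E2, (e ∩ Y).card = 2 ∧ (e ∩ X).card = 1 := by
    intro e he
    obtain ⟨heH, a, ha, b, hb, c, hc, rfl⟩ := mem_filter.mp he
    have hr : ({a, b, c} : Finset (Fin n)) = {b, c, a} := by
      ext z; simp only [mem_insert, mem_singleton]; tauto
    have := h3 _ heH
    rw [hr] at this ⊢
    exact aux_edge Y X hd.symm b c a hb hc ha this
  have hdis : Disjoint E1 E2 := by
    rw [disjoint_left]
    intro e h1 h2
    have := (p1 e h1).1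
    have := (p2 e h2).2
    omega
  have hlow : ∑ e ∈ E1, (Q.filter (fun S => e ⊆ S)).card +
      ∑ e ∈ E2, (Q.filter (fun S => e ⊆ S)).card ≤
      ∑ e ∈ H, (Q.filter (fun S => e ⊆ S)).card := by
    rw [← sum_union hdis]
    exact sum_le_sum_of_subset (union_subset (filter_subset _ _) (filter_subset _ _))
  have l1 : ((Y.card : ℝ) - 1) * (E1.card : ℝ) ≤
      ((∑ e ∈ E1, (Q.filter (fun S => e ⊆ S)).card : ℕ) : ℝ) := by
    push_cast
    rw [mul_comm, ← nsmul_eq_mul]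
    apply card_nsmul_le_sum
    intro e he
    have := aux_ext X Y hd e (p1 e he).1 (p1 e he).2
    rw [← filter_filter, ← hQ] at this
    have : (Y.card : ℝ) ≤ ((Q.filter (fun S => e ⊆ S)).card : ℝ) + 1 := by exact_mod_cast this
    linarith
  have l2 : ((X.card : ℝ) - 1) * (E2.card : ℝ) ≤
      ((∑ e ∈ E2, (Q.filter (fun S => e ⊆ S)).card : ℕ) : ℝ) := by
    push_cast
    rw [mul_comm, ← nsmul_eq_mul]
    apply card_nsmul_le_sum
    intro e he
    have := aux_ext Y X hd.symm e (p2 e he).1 (p2 e he).2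
    simp only [and_comm (a := (_ ∩ Y).card = 2)] at this
    rw [← filter_filter, ← hQ] at this
    have : (X.card : ℝ) ≤ ((Q.filter (fun S => e ⊆ S)).card : ℝ) + 1 := by exact_mod_cast this
    linarith
  have htot : ((∑ e ∈ E1, (Q.filter (fun S => e ⊆ S)).card : ℕ) : ℝ) +
      ((∑ e ∈ E2, (Q.filter (fun S => e ⊆ S)).card : ℕ) : ℝ) ≤ 2 * Q.card + 2 * K.card := by
    exact_mod_cast hlow.trans (hdc ▸ hub)
  have hQr : (Q.card : ℝ) ≤ (X.card.choose 2 : ℝ) * (Y.card.choose 2 : ℝ) := by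
    exact_mod_cast hQc
  rw [c1, c2]
  linarith
end

section
/- Whenever constants satisfy the hierarchy 0 < 1/n ≪ η' ≪ η, ε, 1/c, 1/p with c,p ∈ ℕ, the following holds: let H be a 3-graph on n vertices and let X, Y ⊆ V(H) be disjoint sets such that both X and Y are (c,η)-closed in H. If there exist at least εn^{4p+1} (X,Y)-bridges of length p, then X ∪ Y is (2c+p, η')-closed in H. -/
open Finset

theorem factor_union {n : ℕ} {H : Finset (Finset (Fin n))} {A B : Finset (Fin n)}
    (hA : HasK4mFactorOn H A) (hB : HasK4mFactorOn H B) (hd : Disjoint A B) :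
    HasK4mFactorOn H (A ∪ B) := by
  classical
  obtain ⟨P, hP1, hP2, hP3⟩ := hA
  obtain ⟨Q, hQ1, hQ2, hQ3⟩ := hB
  have hPs : ∀ S ∈ P, S ⊆ A := fun S hS => by
    rw [← hP3]; exact Finset.subset_biUnion_of_mem id hS
  have hQs : ∀ S ∈ Q, S ⊆ B := fun S hS => by
    rw [← hQ3]; exact Finset.subset_biUnion_of_mem id hS
  refine ⟨P ∪ Q, ?_, ?_, ?_⟩
  · intro S hS
    rcases Finset.mem_union.1 hS with h | h
    · exact hP1 S h
    · exact hQ1 S h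
  · intro S hS T hT hne
    rcases Finset.mem_union.1 hS with h | h <;> rcases Finset.mem_union.1 hT with h' | h'
    · exact hP2 S h T h' hne
    · exact Finset.disjoint_of_subset_left (hPs S h) (Finset.disjoint_of_subset_right (hQs T h') hd)
    · exact (Finset.disjoint_of_subset_left (hPs T h')
        (Finset.disjoint_of_subset_right (hQs S h) hd)).symm
    · exact hQ2 S h T h' hne
  · rw [Finset.union_biUnion, hP3, hQ3]

theorem card_sets_le (n k : ℕ) : ((Finset.univ : Finset (Fin n)).powersetCard k).card ≤ n ^ k := by
  rw [Finset.card_powersetCard, Finset.card_univ, Fintype.card_fin]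
  exact Nat.choose_le_pow n k

/-- Few `(k+1)`-sets meet a given set `Z`. -/
theorem card_meet_le {n k : ℕ} (F : Finset (Finset (Fin n))) (hF : ∀ S ∈ F, S.card = k + 1)
    (Z : Finset (Fin n)) :
    (F.filter fun S => ¬ Disjoint S Z).card ≤ Z.card * n ^ k := by
  classical
  have hsub : (F.filter fun S => ¬ Disjoint S Z) ⊆
      (Z ×ˢ (Finset.univ : Finset (Fin n)).powersetCard k).image (fun q => insert q.1 q.2) := by
    intro S hS
    rw [Finset.mem_filter] at hS
    obtain ⟨z, hz1, hz2⟩ := Finset.not_disjoint_iff.1 hS.2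
    rw [Finset.mem_image]
    refine ⟨(z, S.erase z), ?_, Finset.insert_erase hz1⟩
    rw [Finset.mem_product]
    refine ⟨hz2, ?_⟩
    rw [Finset.mem_powersetCard]
    refine ⟨Finset.subset_univ _, ?_⟩
    show (S.erase z).card = k
    rw [Finset.card_erase_of_mem hz1, hF S hS.1]; rfl
  refine (Finset.card_le_card hsub).trans (Finset.card_image_le.trans ?_)
  rw [Finset.card_product]
  exact Nat.mul_le_mul_left _ (card_sets_le n k)

theorem card_avoid {n k : ℕ} (F : Finset (Finset (Fin n))) (hF : ∀ S ∈ F, S.card = k + 1)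
    (Z : Finset (Fin n)) (K : ℕ) (hZ : Z.card ≤ K) (η : ℝ) (hη : 0 < η)
    (hn : 2 * K / η ≤ n) (hc : η * (n : ℝ) ^ (k + 1) ≤ F.card) :
    η / 2 * (n : ℝ) ^ (k + 1) ≤ (F.filter fun S => Disjoint S Z).card := by
  have h1 := card_meet_le F hF Z
  have h2 := Finset.card_filter_add_card_filter_not (s := F) (fun S => Disjoint S Z)
  have h3 : (F.card : ℝ) ≤ (F.filter fun S => Disjoint S Z).card + K * (n : ℝ) ^ k := by
    have : F.card ≤ (F.filter fun S => Disjoint S Z).card + K * n ^ k := by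
      have := Nat.mul_le_mul_right (n ^ k) hZ
      omega
    exact_mod_cast this
  have h4 : (K : ℝ) ≤ η / 2 * n := by
    rw [div_le_iff₀ hη] at hn; linarith
  have h5 : (K : ℝ) * (n : ℝ) ^ k ≤ η / 2 * n * (n : ℝ) ^ k :=
    mul_le_mul_of_nonneg_right h4 (by positivity)
  rw [pow_succ] at *
  linarith

theorem card_bridge_avoid {n q : ℕ} (B : Finset (Fin n × Fin n × Finset (Fin n)))
    (hB : ∀ t ∈ B, t.2.2.card = q + 1) (Z : Finset (Fin n)) (K : ℕ) (hZ : Z.card ≤ K)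
    (ε : ℝ) (hε : 0 < ε) (hn : 6 * K / ε ≤ n) (hc : ε * (n : ℝ) ^ (q + 3) ≤ B.card) :
    ε / 2 * (n : ℝ) ^ (q + 3) ≤
      (B.filter fun t => t.1 ∉ Z ∧ t.2.1 ∉ Z ∧ Disjoint t.2.2 Z).card := by
  classical
  have hsub : (B.filter fun t => ¬ (t.1 ∉ Z ∧ t.2.1 ∉ Z ∧ Disjoint t.2.2 Z)) ⊆
      (Z ×ˢ (Finset.univ : Finset (Fin n)) ×ˢ (Finset.univ : Finset (Fin n)).powersetCard (q + 1)) ∪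
      ((Finset.univ : Finset (Fin n)) ×ˢ Z ×ˢ (Finset.univ : Finset (Fin n)).powersetCard (q + 1)) ∪
      ((Finset.univ : Finset (Fin n)) ×ˢ (Finset.univ : Finset (Fin n)) ×ˢ
        (((Finset.univ : Finset (Fin n)).powersetCard (q + 1)).filter fun S => ¬ Disjoint S Z)) := by
    intro t ht
    rw [Finset.mem_filter] at ht
    have := hB t ht.1
    simp only [Finset.mem_union, Finset.mem_product, Finset.mem_univ, Finset.mem_powersetCard,
      Finset.subset_univ, true_and, Finset.mem_filter]
    tauto
  have h0 := card_sets_le n (q + 1)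
  have hm := card_meet_le (k := q) ((Finset.univ : Finset (Fin n)).powersetCard (q + 1))
    (fun S hS => (Finset.mem_powersetCard.1 hS).2) Z
  have h1 := (Finset.card_le_card hsub).trans
    ((Finset.card_union_le _ _).trans (Nat.add_le_add_right (Finset.card_union_le _ _) _))
  simp only [Finset.card_product, Finset.card_univ, Fintype.card_fin] at h1
  have e1 : Z.card * (n * ((Finset.univ : Finset (Fin n)).powersetCard (q + 1)).card)
      ≤ K * (n * n ^ (q + 1)) := by gcongr
  have e2 : n * (Z.card * ((Finset.univ : Finset (Fin n)).powersetCard (q + 1)).card)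
      ≤ n * (K * n ^ (q + 1)) := by gcongr
  have e3 : n * (n * (((Finset.univ : Finset (Fin n)).powersetCard (q + 1)).filter
      fun S => ¬ Disjoint S Z).card) ≤ n * (n * (K * n ^ q)) := by
    gcongr; exact hm.trans (by gcongr)
  have h2 := Finset.card_filter_add_card_filter_not (s := B)
    (fun t => t.1 ∉ Z ∧ t.2.1 ∉ Z ∧ Disjoint t.2.2 Z)
  have h3 : B.card ≤ (B.filter fun t => t.1 ∉ Z ∧ t.2.1 ∉ Z ∧ Disjoint t.2.2 Z).card
      + 3 * K * n ^ (q + 2) := by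
    have e4 : K * (n * n ^ (q + 1)) = K * n ^ (q + 2) := by ring
    have e5 : n * (K * n ^ (q + 1)) = K * n ^ (q + 2) := by ring
    have e6 : n * (n * (K * n ^ q)) = K * n ^ (q + 2) := by ring
    have e7 : 3 * K * n ^ (q + 2) = 3 * (K * n ^ (q + 2)) := by ring
    omega
  have h3' : (B.card : ℝ) ≤ (B.filter fun t => t.1 ∉ Z ∧ t.2.1 ∉ Z ∧ Disjoint t.2.2 Z).card
      + 3 * K * (n : ℝ) ^ (q + 2) := by exact_mod_cast h3
  have h4 : 3 * (K : ℝ) ≤ ε / 2 * n := by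
    rw [div_le_iff₀ hε] at hn; linarith
  have h5 : 3 * (K : ℝ) * (n : ℝ) ^ (q + 2) ≤ ε / 2 * n * (n : ℝ) ^ (q + 2) :=
    mul_le_mul_of_nonneg_right h4 (by positivity)
  have h6 : (n : ℝ) ^ (q + 3) = (n : ℝ) ^ (q + 2) * n := pow_succ _ _
  rw [h6] at hc ⊢
  linarith

/-- The union built from a bridge and two connectors. -/
def glue {n : ℕ} (a b : Fin n) (S S1 S2 : Finset (Fin n)) : Finset (Fin n) :=
  insert a (insert b (S ∪ S1 ∪ S2))

/-- Abstract counting lemma. -/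
theorem counting {n k q : ℕ} (B : Finset (Fin n × Fin n × Finset (Fin n)))
    (hB : ∀ t ∈ B, t.2.2.card = q + 1) (Z : Finset (Fin n)) (hZ : Z.card ≤ 3)
    (ε η : ℝ) (hε : 0 < ε) (hη : 0 < η) (m : ℕ) (hm : m = 2 * k + q + 5)
    (hn : 18 / ε ≤ n) (hn' : 2 * ((m + 5 : ℕ) : ℝ) / η ≤ n)
    (hc : ε * (n : ℝ) ^ (q + 3) ≤ B.card)
    (F1 F2 : Fin n → Finset (Finset (Fin n)))
    (hF1 : ∀ a, ∀ S ∈ F1 a, S.card = k + 1) (hF2 : ∀ a, ∀ S ∈ F2 a, S.card = k + 1)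
    (hc1 : ∀ t ∈ B, t.1 ∉ Z → η * (n : ℝ) ^ (k + 1) ≤ (F1 t.1).card)
    (hc2 : ∀ t ∈ B, t.2.1 ∉ Z → η * (n : ℝ) ^ (k + 1) ≤ (F2 t.2.1).card)
    (C : Finset (Finset (Fin n)))
    (hC : ∀ a b S, (a, b, S) ∈ B → a ∉ Z → b ∉ Z → Disjoint S Z →
      ∀ S1 ∈ F1 a, Disjoint S1 (Z ∪ {a, b} ∪ S) →
      ∀ S2 ∈ F2 b, Disjoint S2 (Z ∪ {a, b} ∪ S ∪ S1) → glue a b S S1 S2 ∈ C) :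
    ε * η ^ 2 / 8 * (n : ℝ) ^ m ≤ (m ^ 2 * (2 ^ m) ^ 3 : ℕ) * (C.card : ℝ) := by
  classical
  set B' := B.filter fun t => t.1 ∉ Z ∧ t.2.1 ∉ Z ∧ Disjoint t.2.2 Z with hB'
  let G1 : Fin n × Fin n × Finset (Fin n) → Finset (Finset (Fin n)) := fun t =>
    (F1 t.1).filter fun S1 => Disjoint S1 (Z ∪ {t.1, t.2.1} ∪ t.2.2)
  let G2 : Fin n × Fin n × Finset (Fin n) → Finset (Fin n) → Finset (Finset (Fin n)) :=
    fun t S1 => (F2 t.2.1).filter fun S2 => Disjoint S2 (Z ∪ {t.1, t.2.1} ∪ t.2.2 ∪ S1)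
  have hBc : ε / 2 * (n : ℝ) ^ (q + 3) ≤ B'.card :=
    card_bridge_avoid B hB Z 3 hZ ε hε (by norm_num; exact hn) hc
  have hZ1 : ∀ t ∈ B, (Z ∪ {t.1, t.2.1} ∪ t.2.2).card ≤ 3 + 2 + (q + 1) := by
    intro t ht
    refine (Finset.card_union_le _ _).trans ?_
    have := Finset.card_union_le Z {t.1, t.2.1}
    have h2 : ({t.1, t.2.1} : Finset (Fin n)).card ≤ 2 := Finset.card_le_two
    rw [hB t ht]; omega
  have hG1 : ∀ t ∈ B', η / 2 * (n : ℝ) ^ (k + 1) ≤ (G1 t).card := by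
    intro t ht
    rw [hB', Finset.mem_filter] at ht
    exact card_avoid (F1 t.1) (hF1 _) _ (m + 5) ((hZ1 t ht.1).trans (by omega)) η hη hn'
      (hc1 t ht.1 ht.2.1)
  have hG2 : ∀ t ∈ B', ∀ S1 ∈ G1 t, η / 2 * (n : ℝ) ^ (k + 1) ≤ (G2 t S1).card := by
    intro t ht S1 hS1
    rw [hB', Finset.mem_filter] at ht
    refine card_avoid (F2 t.2.1) (hF2 _) _ (m + 5) ?_ η hη hn' (hc2 t ht.1 ht.2.2.1)
    refine (Finset.card_union_le _ _).trans ?_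
    have h1 := hZ1 t ht.1
    rw [hF1 _ S1 (Finset.mem_filter.1 hS1).1]
    omega
  let T : Finset (Σ _ : Fin n × Fin n × Finset (Fin n), Σ _ : Finset (Fin n), Finset (Fin n)) :=
    B'.sigma fun t => (G1 t).sigma fun S1 => G2 t S1
  have hT : ε * η ^ 2 / 8 * (n : ℝ) ^ m ≤ T.card := by
    have hin : ∀ t ∈ B', (η / 2 * (n : ℝ) ^ (k + 1)) * (η / 2 * (n : ℝ) ^ (k + 1)) ≤
        (((G1 t).sigma fun S1 => G2 t S1).card : ℝ) := by
      intro t ht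
      rw [Finset.card_sigma, Nat.cast_sum]
      have := Finset.card_nsmul_le_sum (G1 t) (fun S1 => ((G2 t S1).card : ℝ)) _ (hG2 t ht)
      rw [nsmul_eq_mul] at this
      exact (mul_le_mul_of_nonneg_right (hG1 t ht) (by positivity)).trans this
    rw [Finset.card_sigma, Nat.cast_sum]
    have := Finset.card_nsmul_le_sum B'
      (fun t => (((G1 t).sigma fun S1 => G2 t S1).card : ℝ)) _ hin
    rw [nsmul_eq_mul] at this
    refine le_trans ?_ ((mul_le_mul_of_nonneg_right hBc (by positivity)).trans this)
    apply le_of_eq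
    subst hm
    ring
  let f : (Σ _ : Fin n × Fin n × Finset (Fin n), Σ _ : Finset (Fin n), Finset (Fin n)) →
      Finset (Fin n) := fun s => glue s.1.1 s.1.2.1 s.1.2.2 s.2.1 s.2.2
  have hcard : ∀ s ∈ T, (f s).card ≤ m := by
    intro s hs
    have hs1 := Finset.mem_sigma.1 hs
    have hs2 := Finset.mem_sigma.1 hs1.2
    have c0 := hB _ (Finset.mem_filter.1 hs1.1).1
    have c1 := hF1 _ _ (Finset.mem_filter.1 hs2.1).1
    have c2 := hF2 _ _ (Finset.mem_filter.1 hs2.2).1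
    have d1 := Finset.card_insert_le s.1.1 (insert s.1.2.1 (s.1.2.2 ∪ s.2.1 ∪ s.2.2))
    have d2 := Finset.card_insert_le s.1.2.1 (s.1.2.2 ∪ s.2.1 ∪ s.2.2)
    have d3 := Finset.card_union_le (s.1.2.2 ∪ s.2.1) s.2.2
    have d4 := Finset.card_union_le s.1.2.2 s.2.1
    show (insert s.1.1 (insert s.1.2.1 (s.1.2.2 ∪ s.2.1 ∪ s.2.2))).card ≤ m
    omega
  have hmap : ∀ s ∈ T, f s ∈ C := by
    intro s hs
    have hs1 := Finset.mem_sigma.1 hs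
    have hs2 := Finset.mem_sigma.1 hs1.2
    have c0 := Finset.mem_filter.1 hs1.1
    have c1 := Finset.mem_filter.1 hs2.1
    have c2 := Finset.mem_filter.1 hs2.2
    exact hC _ _ _ c0.1 c0.2.1 c0.2.2.1 c0.2.2.2 _ c1.1 c1.2 _ c2.1 c2.2
  have hfib : ∀ U ∈ C, (T.filter fun s => f s = U).card ≤ m ^ 2 * (2 ^ m) ^ 3 := by
    intro U _
    by_cases hU : U.card ≤ m
    · have : (T.filter fun s => f s = U).card ≤
          (U ×ˢ U ×ˢ U.powerset ×ˢ U.powerset ×ˢ U.powerset).card := by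
        refine Finset.card_le_card_of_injOn
          (fun s => (s.1.1, s.1.2.1, s.1.2.2, s.2.1, s.2.2)) ?_ ?_
        · intro s hs
          have hs' := (Finset.mem_filter.1 (Finset.mem_coe.1 hs)).2
          have hU' : U = insert s.1.1 (insert s.1.2.1 (s.1.2.2 ∪ s.2.1 ∪ s.2.2)) := hs'.symm
          rw [Finset.mem_coe]
          simp only [Finset.mem_product, Finset.mem_powerset]
          refine ⟨?_, ?_, ?_, ?_, ?_⟩
          · simp [hU']
          · simp [hU']
          · intro v hv; simp [hU', hv]
          · intro v hv; simp [hU', hv]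
          · intro v hv; simp [hU', hv]
        · rintro ⟨⟨a, b, S⟩, S1, S2⟩ _ ⟨⟨a', b', S'⟩, S1', S2'⟩ _ h
          simp only [Prod.mk.injEq] at h
          obtain ⟨rfl, rfl, rfl, rfl, rfl⟩ := h
          rfl
      refine this.trans ?_
      simp only [Finset.card_product, Finset.card_powerset]
      have h2 : 2 ^ U.card ≤ 2 ^ m := Nat.pow_le_pow_right (by norm_num) hU
      calc U.card * (U.card * (2 ^ U.card * (2 ^ U.card * 2 ^ U.card)))
          ≤ m * (m * (2 ^ m * (2 ^ m * 2 ^ m))) := by gcongr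
        _ = _ := by ring
    · have : (T.filter fun s => f s = U) = ∅ := by
        apply Finset.filter_eq_empty_iff.2
        intro s hs h
        exact hU (h ▸ hcard s hs)
      rw [this]; simp
  have := Finset.card_le_mul_card_image_of_maps_to hmap _ hfib
  refine hT.trans ?_
  exact_mod_cast this

theorem IsConnector.symm' {n : ℕ} {H : Finset (Finset (Fin n))} {c : ℕ} {x y : Fin n}
    {S : Finset (Fin n)} (h : IsConnector H c x y S) : IsConnector H c y x S :=
  ⟨h.2.1, h.1, h.2.2.1, h.2.2.2.2, h.2.2.2.1⟩

theorem close_symm {n : ℕ} {H : Finset (Finset (Fin n))} {c : ℕ} {η : ℝ} {x y : Fin n}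
    (h : Close H c η x y) : Close H c η y x := by
  have : {S : Finset (Fin n) | IsConnector H c x y S} = {S | IsConnector H c y x S} := by
    ext S; exact ⟨fun h => h.symm', fun h => h.symm'⟩
  unfold Close at *
  rwa [← this]

theorem bridge_symm {n : ℕ} (H : Finset (Finset (Fin n))) (c : ℕ) (X Y : Finset (Fin n)) :
    BridgeCount H c X Y = BridgeCount H c Y X := by
  unfold BridgeCount
  refine Set.ncard_congr (fun t _ => (t.2.1, t.1, t.2.2)) ?_ ?_ ?_
  · rintro ⟨a, b, S⟩ ⟨h1, h2, h3⟩
    exact ⟨h2, h1, h3.symm'⟩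
  · rintro ⟨a, b, S⟩ ⟨a', b', S'⟩ _ _ h
    simp only [Prod.mk.injEq] at h ⊢
    tauto
  · rintro ⟨a, b, S⟩ ⟨h1, h2, h3⟩
    exact ⟨(b, a, S), ⟨h2, h1, h3.symm'⟩, rfl⟩

/-- Gluing three pieces. -/
theorem factor_three {n : ℕ} {H : Finset (Finset (Fin n))} {A B C U : Finset (Fin n)}
    (hA : HasK4mFactorOn H A) (hB : HasK4mFactorOn H B) (hC : HasK4mFactorOn H C)
    (hAB : Disjoint A B) (hAC : Disjoint A C) (hBC : Disjoint B C) (hU : U = A ∪ B ∪ C) :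
    HasK4mFactorOn H U := by
  rw [hU]
  exact factor_union (factor_union hA hB hAB) hC (Finset.disjoint_union_left.2 ⟨hAC, hBC⟩)

theorem glue_card {n : ℕ} {a b : Fin n} {S S1 S2 : Finset (Fin n)} (hab : a ≠ b)
    (ha : a ∉ S) (hb : b ∉ S) (h1 : Disjoint S1 ({a, b} ∪ S)) (h2 : Disjoint S2 ({a, b} ∪ S ∪ S1)) :
    (glue a b S S1 S2).card = S.card + S1.card + S2.card + 2 := by
  classical
  simp only [Finset.disjoint_union_right, Finset.disjoint_insert_right,
    Finset.disjoint_singleton_right] at h1 h2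
  unfold glue
  rw [Finset.card_insert_of_notMem, Finset.card_insert_of_notMem, Finset.card_union_of_disjoint,
    Finset.card_union_of_disjoint]
  · exact h1.2.symm
  · exact Finset.disjoint_union_left.2 ⟨h2.1.2.symm, h2.2.symm⟩
  · simp; tauto
  · simp; tauto

set_option maxHeartbeats 8000000 in
theorem half {n c p : ℕ} (hc : 0 < c) (hp : 0 < p) (η ε η' : ℝ) (hη : 0 < η) (hε : 0 < ε)
    (m : ℕ) (hm : m = 8 * c + 4 * p - 1)
    (hη' : η' ≤ ε * η ^ 2 / 8 / (m ^ 2 * (2 ^ m) ^ 3 : ℕ))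
    (hn : 18 / ε ≤ n) (hn' : 2 * ((m + 5 : ℕ) : ℝ) / η ≤ n) (hn0 : 0 < n)
    (H : Finset (Finset (Fin n))) (X Y : Finset (Fin n)) (hXY : Disjoint X Y)
    (hX : ClosedOn H c η X) (hY : ClosedOn H c η Y)
    (hb : ε * (n : ℝ) ^ (4 * p + 1) ≤ (BridgeCount H p X Y : ℝ))
    (x y : Fin n) (hx : x ∈ X) (hy : y ∈ X ∪ Y) (hxy : x ≠ y) :
    Close H (2 * c + p) η' x y := by
  classical
  obtain ⟨k, hk⟩ : ∃ k, 4 * c - 1 = k + 1 := ⟨4 * c - 2, by omega⟩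
  obtain ⟨q, hq⟩ : ∃ q, 4 * p - 1 = q + 1 := ⟨4 * p - 2, by omega⟩
  have hm' : m = 2 * k + q + 5 := by omega
  have hq3 : 4 * p + 1 = q + 3 := by omega
  let B : Finset (Fin n × Fin n × Finset (Fin n)) := Finset.univ.filter fun t =>
    t.1 ∈ X ∧ t.2.1 ∈ Y ∧ IsConnector H p t.1 t.2.1 t.2.2
  have hBc : BridgeCount H p X Y = B.card := by
    unfold BridgeCount
    rw [← Set.ncard_coe_finset]
    congr 1
    ext t; simp [B]
  have hBm : ∀ t, t ∈ B ↔ t.1 ∈ X ∧ t.2.1 ∈ Y ∧ IsConnector H p t.1 t.2.1 t.2.2 := by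
    intro t; simp [B]
  have hBq : ∀ t ∈ B, t.2.2.card = q + 1 := fun t ht => by
    rw [((hBm t).1 ht).2.2.2.2.1, hq]
  let K : ℕ → Fin n → Fin n → Finset (Finset (Fin n)) := fun c u v =>
    Finset.univ.filter fun S => IsConnector H c u v S
  have hKm : ∀ c u v S, S ∈ K c u v ↔ IsConnector H c u v S := by
    intro c u v S; simp [K]
  have hKc : ∀ c u v, {S : Finset (Fin n) | IsConnector H c u v S}.ncard = (K c u v).card := by
    intro c u v
    rw [← Set.ncard_coe_finset]
    congr 1
    ext t; simp [K]
  have hKk : ∀ u v, ∀ S ∈ K c u v, S.card = k + 1 := fun u v S hS => by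
    rw [((hKm _ _ _ _).1 hS).2.2.1, hk]
  have hclose : ∀ u v, Close H c η u v → η * (n : ℝ) ^ (k + 1) ≤ (K c u v).card := by
    intro u v h
    unfold Close at h
    rwa [hKc, hk] at h
  rw [hBc, hq3] at hb
  have hBne : B.Nonempty := by
    rw [← Finset.card_pos]
    have : (0 : ℝ) < B.card := lt_of_lt_of_le (by positivity) hb
    exact_mod_cast this
  have key : ε * η ^ 2 / 8 * (n : ℝ) ^ m ≤
      (m ^ 2 * (2 ^ m) ^ 3 : ℕ) * ((K (2 * c + p) x y).card : ℝ) := by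
    rcases Finset.mem_union.1 hy with hyX | hyY
    · obtain ⟨t0, ht0⟩ := hBne
      obtain ⟨y0, hy0⟩ : ∃ y0, y0 ∈ Y := ⟨_, ((hBm t0).1 ht0).2.1⟩
      refine counting (k := k) (q := q) B hBq {x, y, y0} Finset.card_le_three ε η hε hη m hm' hn hn'
        hb (fun _ => K c x y) (fun b => K c b y0) (fun _ => hKk _ _) (fun _ => hKk _ _)
        (fun t _ _ => hclose _ _ (hX x hx y hyX hxy)) ?_ _ ?_
      · intro t ht hz
        refine hclose _ _ (hY _ ((hBm t).1 ht).2.1 _ hy0 ?_)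
        rintro h; simp [h] at hz
      · intro a b S hS haZ hbZ hSZ S1 hS1 hd1 S2 hS2 hd2
        obtain ⟨haX, hbY, hS⟩ := (hBm _).1 hS
        dsimp only at haX hbY hS
        rw [hKm] at hS1 hS2 ⊢
        have hab : a ≠ b := fun h => Finset.disjoint_left.1 hXY haX (h ▸ hbY)
        have hcard := glue_card (S1 := S1) (S2 := S2) hab hS.1 hS.2.1
          (hd1.mono_right (by rw [Finset.union_assoc]; exact Finset.subset_union_right))
          (hd2.mono_right (by
            rw [Finset.union_assoc, Finset.union_assoc, Finset.union_assoc]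
            exact Finset.subset_union_right))
        obtain ⟨a1, a2, a3, a4, a5⟩ := hS
        obtain ⟨b1, b2, b3, b4, b5⟩ := hS1
        obtain ⟨c1, c2, c3, c4, c5⟩ := hS2
        simp only [Finset.disjoint_union_right, Finset.disjoint_insert_right,
          Finset.disjoint_singleton_right, Finset.mem_insert, Finset.mem_singleton,
          not_or] at haZ hbZ hSZ hd1 hd2
        have hd1' := hd1.2.symm
        have hd2' := hd2.1.2.symm
        have hd2'' := hd2.2.symm
        refine ⟨?_, ?_, ?_, ?_, ?_⟩
        · simp only [glue, Finset.mem_insert, Finset.mem_union]; grind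
        · simp only [glue, Finset.mem_insert, Finset.mem_union]; grind
        · rw [hcard]; omega
        · refine factor_three b4 a4 c4 ?_ ?_ ?_ ?_
          · simp only [Finset.disjoint_insert_left, Finset.disjoint_insert_right,
              Finset.mem_insert]; grind
          · simp only [Finset.disjoint_insert_left, Finset.disjoint_insert_right,
              Finset.mem_insert]; grind
          · simp only [Finset.disjoint_insert_left, Finset.disjoint_insert_right,
              Finset.mem_insert]; grind
          · ext v; simp only [glue, Finset.mem_insert, Finset.mem_union]; grind
        · refine factor_three b5 a4 c4 ?_ ?_ ?_ ?_
          · simp only [Finset.disjoint_insert_left, Finset.disjoint_insert_right,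
              Finset.mem_insert]; grind
          · simp only [Finset.disjoint_insert_left, Finset.disjoint_insert_right,
              Finset.mem_insert]; grind
          · simp only [Finset.disjoint_insert_left, Finset.disjoint_insert_right,
              Finset.mem_insert]; grind
          · ext v; simp only [glue, Finset.mem_insert, Finset.mem_union]; grind
    · refine counting (k := k) (q := q) B hBq {x, y} (Finset.card_le_two.trans (by norm_num))
        ε η hε hη m hm' hn hn'
        hb (fun a => K c x a) (fun b => K c b y) (fun _ => hKk _ _) (fun _ => hKk _ _)
        ?_ ?_ _ ?_
      · intro t ht hz
        refine hclose _ _ (hX _ hx _ ((hBm t).1 ht).1 ?_)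
        rintro h; simp [h] at hz
      · intro t ht hz
        refine hclose _ _ (hY _ ((hBm t).1 ht).2.1 _ hyY ?_)
        rintro h; simp [h] at hz
      · intro a b S hS haZ hbZ hSZ S1 hS1 hd1 S2 hS2 hd2
        obtain ⟨haX, hbY, hS⟩ := (hBm _).1 hS
        dsimp only at haX hbY hS
        rw [hKm] at hS1 hS2 ⊢
        have hab : a ≠ b := fun h => Finset.disjoint_left.1 hXY haX (h ▸ hbY)
        have hcard := glue_card (S1 := S1) (S2 := S2) hab hS.1 hS.2.1
          (hd1.mono_right (by rw [Finset.union_assoc]; exact Finset.subset_union_right))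
          (hd2.mono_right (by
            rw [Finset.union_assoc, Finset.union_assoc, Finset.union_assoc]
            exact Finset.subset_union_right))
        obtain ⟨a1, a2, a3, a4, a5⟩ := hS
        obtain ⟨b1, b2, b3, b4, b5⟩ := hS1
        obtain ⟨c1, c2, c3, c4, c5⟩ := hS2
        simp only [Finset.disjoint_union_right, Finset.disjoint_insert_right,
          Finset.disjoint_singleton_right, Finset.mem_insert, Finset.mem_singleton,
          not_or] at haZ hbZ hSZ hd1 hd2
        have hd1' := hd1.2.symm
        have hd2' := hd2.1.2.symm
        have hd2'' := hd2.2.symm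
        refine ⟨?_, ?_, ?_, ?_, ?_⟩
        · simp only [glue, Finset.mem_insert, Finset.mem_union]; grind
        · simp only [glue, Finset.mem_insert, Finset.mem_union]; grind
        · rw [hcard]; omega
        · refine factor_three b4 a4 c4 ?_ ?_ ?_ ?_
          · simp only [Finset.disjoint_insert_left, Finset.disjoint_insert_right,
              Finset.mem_insert]; grind
          · simp only [Finset.disjoint_insert_left, Finset.disjoint_insert_right,
              Finset.mem_insert]; grind
          · simp only [Finset.disjoint_insert_left, Finset.disjoint_insert_right,
              Finset.mem_insert]; grind
          · ext v; simp only [glue, Finset.mem_insert, Finset.mem_union]; grind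
        · refine factor_three b5 a5 c5 ?_ ?_ ?_ ?_
          · simp only [Finset.disjoint_insert_left, Finset.disjoint_insert_right,
              Finset.mem_insert]; grind
          · simp only [Finset.disjoint_insert_left, Finset.disjoint_insert_right,
              Finset.mem_insert]; grind
          · simp only [Finset.disjoint_insert_left, Finset.disjoint_insert_right,
              Finset.mem_insert]; grind
          · ext v; simp only [glue, Finset.mem_insert, Finset.mem_union]; grind
  unfold Close
  rw [hKc, show 4 * (2 * c + p) - 1 = m by omega]
  have hM : (0 : ℝ) < (m ^ 2 * (2 ^ m) ^ 3 : ℕ) := by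
    have : 0 < m := by omega
    exact_mod_cast (by positivity : 0 < m ^ 2 * (2 ^ m) ^ 3)
  calc η' * (n : ℝ) ^ m ≤ ε * η ^ 2 / 8 / (m ^ 2 * (2 ^ m) ^ 3 : ℕ) * (n : ℝ) ^ m := by gcongr
    _ = ε * η ^ 2 / 8 * (n : ℝ) ^ m / (m ^ 2 * (2 ^ m) ^ 3 : ℕ) := by ring
    _ ≤ _ := by rw [div_le_iff₀ hM, mul_comm]; linarith

/-- many bridges between closed sets merge them into a closed set. -/
theorem stmt_8 (c p : ℕ) (hc : 0 < c) (hp : 0 < p) (η ε : ℝ) (hη : 0 < η) (hε : 0 < ε) :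
    ∃ η'₀ : ℝ, 0 < η'₀ ∧ ∀ η' : ℝ, 0 < η' → η' ≤ η'₀ →
      ∃ n₀ : ℕ, ∀ n : ℕ, n₀ ≤ n →
        ∀ H : Finset (Finset (Fin n)), Is3Graph n H →
          ∀ X Y : Finset (Fin n), Disjoint X Y →
            ClosedOn H c η X → ClosedOn H c η Y →
            ε * (n : ℝ) ^ (4 * p + 1) ≤ (BridgeCount H p X Y : ℝ) →
            ClosedOn H (2 * c + p) η' (X ∪ Y) := by
  obtain ⟨m, hm⟩ : ∃ m, m = 8 * c + 4 * p - 1 := ⟨_, rfl⟩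
  have hM : (0 : ℝ) < (m ^ 2 * (2 ^ m) ^ 3 : ℕ) := by
    have : 0 < m := by omega
    exact_mod_cast (by positivity : 0 < m ^ 2 * (2 ^ m) ^ 3)
  refine ⟨ε * η ^ 2 / 8 / (m ^ 2 * (2 ^ m) ^ 3 : ℕ), by positivity, ?_⟩
  intro η' _ hη'
  refine ⟨max 1 (max ⌈18 / ε⌉₊ ⌈2 * ((m + 5 : ℕ) : ℝ) / η⌉₊), ?_⟩
  intro n hn H _ X Y hXY hX hY hb
  simp only [max_le_iff, Nat.ceil_le] at hn
  obtain ⟨hn0, hn1, hn2⟩ := hn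
  intro x hx y hy hxy
  rcases Finset.mem_union.1 hx with h | h
  · exact half hc hp η ε η' hη hε m hm hη' hn1 hn2 hn0 H X Y hXY hX hY hb x y h hy hxy
  · rw [bridge_symm] at hb
    exact half hc hp η ε η' hη hε m hm hη' hn1 hn2 hn0 H Y X hXY.symm hY hX hb x y h
      (by rwa [Finset.union_comm]) hxy
end

section
/- Let n ∈ ℕ and 0 < γ ≤ 1/20. Let G be a graph on n vertices with (1/2 − γ)n ≤ δ(G) ≤ Δ(G) ≤ 3n/5, and suppose that |N(x) △ N(y)| ≤ γn for every edge xy ∈ E(G). Then there exists a bipartition V(G) = X ∪ Y such that δ(G[X]), δ(G[Y]) ≥ (1/2 − 5γ)n and (1/2 − 5γ)n ≤ |X|, |Y| ≤ (1/2 + 5γ)n. -/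
open Finset

/-- partitioning a graph with locally similar neighbourhoods. -/
theorem stmt_10 (n : ℕ) (γ : ℝ) (hγ0 : 0 < γ) (hγ : γ ≤ 1 / 20)
    (G : SimpleGraph (Fin n)) [DecidableRel G.Adj]
    (hδ : ∀ v : Fin n, (1 / 2 - γ) * n ≤ (G.degree v : ℝ))
    (hΔ : ∀ v : Fin n, (G.degree v : ℝ) ≤ 3 * n / 5)
    (hsym : ∀ x y : Fin n, G.Adj x y →
      ((symmDiff (G.neighborFinset x) (G.neighborFinset y)).card : ℝ) ≤ γ * n) :
    ∃ X Y : Finset (Fin n), Disjoint X Y ∧ X ∪ Y = Finset.univ ∧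
      (1 / 2 - 5 * γ) * n ≤ (X.card : ℝ) ∧ (X.card : ℝ) ≤ (1 / 2 + 5 * γ) * n ∧
      (1 / 2 - 5 * γ) * n ≤ (Y.card : ℝ) ∧ (Y.card : ℝ) ≤ (1 / 2 + 5 * γ) * n ∧
      (∀ x ∈ X, (1 / 2 - 5 * γ) * n ≤ ((X.filter (G.Adj x)).card : ℝ)) ∧
      (∀ y ∈ Y, (1 / 2 - 5 * γ) * n ≤ ((Y.filter (G.Adj y)).card : ℝ)) := by
  classical
  rcases Nat.eq_zero_or_pos n with hn | hn
  · subst hn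
    exact ⟨∅, ∅, by simp, by ext x; exact x.elim0, by simp, by simp, by simp, by simp,
      by simp, by simp⟩
  have hnR : (0 : ℝ) < n := by exact_mod_cast hn
  have hγn : 0 < γ * n := mul_pos hγ0 hnR
  have hγn' : γ * n ≤ n / 20 := by nlinarith
  let v : Fin n := ⟨0, hn⟩
  obtain ⟨A, hA⟩ : ∃ A, A = G.neighborFinset v := ⟨_, rfl⟩
  have hmemA : ∀ x, x ∈ A ↔ G.Adj v x := by intro x; rw [hA]; simp
  have hAl : (1 / 2 - γ) * n ≤ (A.card : ℝ) := by
    rw [hA, G.card_neighborFinset_eq_degree]; exact hδ v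
  have hAu : (A.card : ℝ) ≤ 3 * n / 5 := by
    rw [hA, G.card_neighborFinset_eq_degree]; exact hΔ v
  have hAsym : ∀ x ∈ A, ((symmDiff A (G.neighborFinset x)).card : ℝ) ≤ γ * n := by
    intro x hx
    have := hsym v x ((hmemA x).1 hx)
    rwa [← hA] at this
  -- neighbours outside the set
  have hout : ∀ x ∈ A, ∀ S : Finset (Fin n), Disjoint S A →
      ((S.filter (G.Adj x)).card : ℝ) ≤ γ * n := by
    intro x hx S hS
    refine le_trans ?_ (hAsym x hx)
    norm_cast
    apply card_le_card
    intro z hz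
    rw [mem_filter] at hz
    rw [mem_symmDiff]
    exact Or.inr ⟨by simpa using hz.2, disjoint_left.1 hS hz.1⟩
  have hin : ∀ x (S : Finset (Fin n)), 
      A.card ≤ (A.filter (G.Adj x)).card + (symmDiff A (G.neighborFinset x)).card := by
    intro x S
    refine le_trans (card_le_card ?_) (card_union_le _ _)
    intro z hz
    by_cases h : G.Adj x z
    · simp [hz, h]
    · simp [mem_symmDiff, hz, h]
  obtain ⟨B, hB⟩ : ∃ B, B = univ.filter (fun w => w ∉ A ∧ ∃ x ∈ A, G.Adj w x) := ⟨_, rfl⟩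
  have hBA : Disjoint B A := by
    rw [disjoint_left, hB]
    intro w hw
    exact (mem_filter.1 hw).2.1
  have hBin : ∀ w ∈ B, (A.card : ℝ) - 2 * (γ * n) ≤ ((A.filter (G.Adj w)).card : ℝ) := by
    intro w hw
    rw [hB, mem_filter] at hw
    obtain ⟨-, -, x, hx, hwx⟩ := hw
    have h1 := hAsym x hx
    have h2 := hsym x w hwx.symm
    have h3 : (symmDiff A (G.neighborFinset w)).card ≤ (symmDiff A (G.neighborFinset x)).card
        + (symmDiff (G.neighborFinset x) (G.neighborFinset w)).card := by
      refine le_trans (card_le_card ?_) (card_union_le _ _)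
      exact symmDiff_triangle _ _ _
    have h4 := hin w A
    have h3' : ((symmDiff A (G.neighborFinset w)).card : ℝ)
        ≤ (symmDiff A (G.neighborFinset x)).card
        + (symmDiff (G.neighborFinset x) (G.neighborFinset w)).card := by exact_mod_cast h3
    have h4' : (A.card : ℝ) ≤ (A.filter (G.Adj w)).card
        + (symmDiff A (G.neighborFinset w)).card := by exact_mod_cast h4
    linarith
  have hdc : ∑ w ∈ B, ((A.filter (G.Adj w)).card : ℝ) = ∑ x ∈ A, ((B.filter (G.Adj x)).card : ℝ) := by
    have := Finset.sum_card_bipartiteAbove_eq_sum_card_bipartiteBelow (s := B) (t := A) G.Adj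
    simp only [bipartiteAbove, bipartiteBelow] at this
    norm_cast
    rw [this]
    refine sum_congr rfl fun x _ => ?_
    congr 1
    ext z
    simp [G.adj_comm]
  have hBcard : (B.card : ℝ) ≤ 2 * (γ * n) := by
    have h1 : (B.card : ℝ) * (A.card - 2 * (γ * n)) ≤ ∑ w ∈ B, ((A.filter (G.Adj w)).card : ℝ) := by
      have := card_nsmul_le_sum B _ _ hBin
      simpa [nsmul_eq_mul] using this
    have h2 : ∑ x ∈ A, ((B.filter (G.Adj x)).card : ℝ) ≤ A.card * (γ * n) := by
      have := sum_le_card_nsmul A (fun x => ((B.filter (G.Adj x)).card : ℝ)) (γ * n)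
        (fun x hx => hout x hx B hBA)
      simpa [nsmul_eq_mul] using this
    have h3 : (A.card : ℝ) / 2 ≤ A.card - 2 * (γ * n) := by linarith
    have h4 : (0 : ℝ) < A.card := by linarith
    have h5 : (B.card : ℝ) * (A.card / 2) ≤ A.card * (γ * n) :=
      le_trans (mul_le_mul_of_nonneg_left h3 (by positivity)) (by linarith)
    by_contra h
    push Not at h
    nlinarith
  have hXc : ((A ∪ B).card : ℝ) ≤ A.card + B.card := by exact_mod_cast card_union_le A B
  have hXl : (A.card : ℝ) ≤ (A ∪ B).card := by exact_mod_cast card_le_card subset_union_left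
  have hXY : ((A ∪ B).card : ℝ) + ((A ∪ B)ᶜ.card : ℝ) = n := by
    have := card_add_card_compl (A ∪ B)
    rw [Fintype.card_fin] at this
    exact_mod_cast this
  have hYdeg : ∀ y ∈ (A ∪ B)ᶜ,
      (1 / 2 - 5 * γ) * n ≤ (((A ∪ B)ᶜ.filter (G.Adj y)).card : ℝ) := by
    intro y hy
    rw [mem_compl, mem_union, not_or] at hy
    have h1 : G.degree y ≤ ((A ∪ B)ᶜ.filter (G.Adj y)).card + B.card := by
      rw [← G.card_neighborFinset_eq_degree]
      refine le_trans (card_le_card ?_) (card_union_le _ _)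
      intro z hz
      rw [G.mem_neighborFinset] at hz
      have hzA : z ∉ A := by
        intro hzA
        apply hy.2
        rw [hB, mem_filter]
        exact ⟨mem_univ _, hy.1, z, hzA, hz⟩
      by_cases hzB : z ∈ B
      · simp [hzB]
      · simp [hzA, hzB, hz]
    have h1' : (G.degree y : ℝ) ≤ ((A ∪ B)ᶜ.filter (G.Adj y)).card + B.card := by
      exact_mod_cast h1
    have := hδ y
    linarith
  have hYl : (1 / 2 - 5 * γ) * n ≤ ((A ∪ B)ᶜ.card : ℝ) := by
    have hne : ((A ∪ B)ᶜ).Nonempty := by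
      rw [← card_pos]
      have : (0 : ℝ) < ((A ∪ B)ᶜ.card : ℝ) := by linarith
      exact_mod_cast this
    obtain ⟨y, hy⟩ := hne
    refine le_trans (hYdeg y hy) ?_
    exact_mod_cast card_filter_le _ _
  refine ⟨A ∪ B, (A ∪ B)ᶜ, disjoint_compl_right, union_compl _, by linarith, by linarith,
    hYl, by linarith, ?_, hYdeg⟩
  intro x hx
  have h1 : ((A.filter (G.Adj x)).card : ℝ) ≤ ((A ∪ B).filter (G.Adj x)).card := by
    exact_mod_cast card_le_card (filter_subset_filter _ subset_union_left)
  rcases mem_union.1 hx with hx | hx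
  · have h4 : (A.card : ℝ) ≤ (A.filter (G.Adj x)).card
        + (symmDiff A (G.neighborFinset x)).card := by exact_mod_cast hin x A
    have := hAsym x hx
    linarith
  · have := hBin x hx
    linarith
end

section
/- Let 0 < 1/n ≪ ε ≪ γ ≪ 1 and let H be a 3-graph on n vertices with δ₂(H) ≥ (1/2 − γ)n. Suppose v ∈ V(H) is such that there are fewer than εn³ edges e ∈ E(H) with v ∈ L(e). Let G := L_v be the link graph of v, and call an edge uw ∈ E(G) good if |N_G(u) ∩ N_H(uw)| ≤ 3√ε·n and |N_G(w) ∩ N_H(uw)| ≤ 3√ε·n, and bad otherwise. Then (i) there are at most √ε·n² bad edges in G, and (ii) if u ∈ V(G) is incident with a good edge, then deg_G(u) ≤ (1/2 + γ + 3√ε)n. -/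
open Finset

/-- `Nset H x y` : the neighbourhood `N_H(xy)` as a set. Note that for a vertex
`v`, the link-graph neighbourhood `N_{L_v}(u)` is `Nset H v u`. -/
def Nset {n : ℕ} (H : Finset (Finset (Fin n))) (x y : Fin n) : Set (Fin n) :=
  {z | ({x, y, z} : Finset (Fin n)) ∈ H}

/-- `uw` is a good edge of the link graph `L_v`. -/
def GoodLinkEdge {n : ℕ} (H : Finset (Finset (Fin n))) (ε : ℝ) (v u w : Fin n) : Prop :=
  ({v, u, w} : Finset (Fin n)) ∈ H ∧
  ((Nset H v u ∩ Nset H u w).ncard : ℝ) ≤ 3 * Real.sqrt ε * n ∧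
  ((Nset H v w ∩ Nset H u w).ncard : ℝ) ≤ 3 * Real.sqrt ε * n

lemma ne_of_triple {n : ℕ} {H : Finset (Finset (Fin n))} (hH : Is3Graph n H) {a b c : Fin n}
    (h : ({a, b, c} : Finset (Fin n)) ∈ H) : a ≠ b ∧ a ≠ c ∧ b ≠ c := by
  have h3 := hH _ h
  refine ⟨?_, ?_, ?_⟩
  · rintro rfl
    have := Finset.card_le_two (a := a) (b := c)
    simp at h3
    omega
  · rintro rfl
    have := Finset.card_le_two (a := b) (b := a)
    rw [Finset.insert_comm] at h3
    simp at h3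
    omega
  · rintro rfl
    have := Finset.card_le_two (a := a) (b := b)
    simp at h3
    omega

lemma spans_of {n : ℕ} {H : Finset (Finset (Fin n))} (hH : Is3Graph n H) {v a b x : Fin n}
    (h1 : ({v, a, b} : Finset (Fin n)) ∈ H) (h2 : ({v, a, x} : Finset (Fin n)) ∈ H)
    (h3 : ({a, b, x} : Finset (Fin n)) ∈ H) :
    SpansK4m H (insert v {a, b, x}) := by
  obtain ⟨va, vb, ab⟩ := ne_of_triple hH h1
  obtain ⟨-, vx, ax⟩ := ne_of_triple hH h2
  obtain ⟨-, -, bx⟩ := ne_of_triple hH h3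
  constructor
  · rw [Finset.card_insert_of_notMem (by simp [va, vb, vx]), hH _ h3]
  · have hs : ({{v, a, b}, {v, a, x}, {a, b, x}} : Finset (Finset (Fin n))) ⊆
        ((insert v {a, b, x} : Finset (Fin n)).powersetCard 3).filter (· ∈ H) := by
      intro e he
      simp only [Finset.mem_insert, Finset.mem_singleton] at he
      simp only [Finset.mem_filter, Finset.mem_powersetCard]
      rcases he with rfl | rfl | rfl
      · refine ⟨⟨?_, hH _ h1⟩, h1⟩
        intro y; simp; tauto
      · refine ⟨⟨?_, hH _ h2⟩, h2⟩
        intro y; simp; tauto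
      · exact ⟨⟨Finset.subset_insert _ _, hH _ h3⟩, h3⟩
    refine le_trans (le_of_eq ?_) (Finset.card_le_card hs)
    symm
    rw [Finset.card_eq_three]
    refine ⟨_, _, _, ?_, ?_, ?_, rfl⟩
    · intro h
      have : b ∈ ({v, a, x} : Finset (Fin n)) := by rw [← h]; simp
      simp [vb.symm, ab.symm, bx] at this
    · intro h
      have : v ∈ ({a, b, x} : Finset (Fin n)) := by rw [← h]; simp
      simp [va, vb, vx] at this
    · intro h
      have : v ∈ ({a, b, x} : Finset (Fin n)) := by rw [← h]; simp
      simp [va, vb, vx] at this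

lemma above_bound {n : ℕ} {H : Finset (Finset (Fin n))} (hH : Is3Graph n H) {v a b : Fin n}
    (h1 : ({v, a, b} : Finset (Fin n)) ∈ H) (T : Finset (Finset (Fin n)))
    (hT : ∀ e, e ∈ H → SpansK4m H (insert v e) → e ∈ T) :
    (Nset H v a ∩ Nset H a b).ncard ≤ (T.filter fun e => ({a, b} : Finset (Fin n)) ⊆ e).card := by
  rw [← Set.ncard_coe_finset]
  refine Set.ncard_le_ncard_of_injOn (fun x => ({a, b, x} : Finset (Fin n))) ?_ ?_
    (Finset.finite_toSet _)
  · rintro x ⟨hx1, hx2⟩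
    simp only [Finset.coe_filter, Set.mem_setOf_eq]
    refine ⟨hT _ hx2 (spans_of hH h1 hx1 hx2), ?_⟩
    intro y; simp; tauto
  · rintro x ⟨hx1, hx2⟩ y ⟨hy1, hy2⟩ hxy
    obtain ⟨-, ax, bx⟩ := ne_of_triple hH hx2
    have : x ∈ ({a, b, y} : Finset (Fin n)) := by
      have h : ({a, b, x} : Finset (Fin n)) = {a, b, y} := hxy
      rw [← h]; simp
    simpa [ax.symm, bx.symm] using this

/-- few bad edges in the link graph of `v`, and degree bounds for
vertices on good edges. -/
theorem stmt_11 :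
    ∃ γ₀ : ℝ, 0 < γ₀ ∧ ∀ γ : ℝ, 0 < γ → γ ≤ γ₀ →
      ∃ ε₀ : ℝ, 0 < ε₀ ∧ ∀ ε : ℝ, 0 < ε → ε ≤ ε₀ →
        ∃ n₀ : ℕ, ∀ n : ℕ, n₀ ≤ n →
          ∀ H : Finset (Finset (Fin n)), Is3Graph n H →
            CodegLB H ((1 / 2 - γ) * n) →
            ∀ v : Fin n,
              ({e : Finset (Fin n) | e ∈ H ∧
                  SpansK4m H (insert v e)}.ncard : ℝ) < ε * (n : ℝ) ^ 3 →
              (({q : Finset (Fin n) | ∃ u w : Fin n, q = {u, w} ∧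
                  ({v, u, w} : Finset (Fin n)) ∈ H ∧
                  ¬ GoodLinkEdge H ε v u w}.ncard : ℝ) ≤ Real.sqrt ε * (n : ℝ) ^ 2) ∧
              ∀ u : Fin n, (∃ w : Fin n, GoodLinkEdge H ε v u w) →
                ((Nset H v u).ncard : ℝ) ≤ (1 / 2 + γ + 3 * Real.sqrt ε) * n := by
  refine ⟨1, one_pos, fun γ _ _ => ⟨1, one_pos, fun ε hε _ => ⟨0, fun n _ H hH hdeg v hfew => ?_⟩⟩⟩
  classical
  have hn : (0 : ℝ) < n := by exact_mod_cast v.pos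
  have hs : 0 < Real.sqrt ε := Real.sqrt_pos.mpr hε
  have hss : Real.sqrt ε * Real.sqrt ε = ε := Real.mul_self_sqrt hε.le
  constructor
  · set T : Finset (Finset (Fin n)) :=
      Finset.univ.filter fun e => e ∈ H ∧ SpansK4m H (insert v e) with hTdef
    set B : Finset (Finset (Fin n)) :=
      Finset.univ.filter fun q => ∃ u w : Fin n, q = {u, w} ∧
                  ({v, u, w} : Finset (Fin n)) ∈ H ∧
                  ¬ GoodLinkEdge H ε v u w with hBdef
    have hTc : (T.card : ℝ) < ε * (n : ℝ) ^ 3 := by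
      rw [← Set.ncard_coe_finset, hTdef]
      simpa using hfew
    have hBc : {q : Finset (Fin n) | ∃ u w : Fin n, q = {u, w} ∧
                  ({v, u, w} : Finset (Fin n)) ∈ H ∧
                  ¬ GoodLinkEdge H ε v u w}.ncard = B.card := by
      rw [← Set.ncard_coe_finset, hBdef]
      simp
    rw [hBc]
    have hT : ∀ e, e ∈ H → SpansK4m H (insert v e) → e ∈ T := by
      intro e h1 h2
      simp [hTdef, h1, h2]
    have key : B.card * ⌈3 * Real.sqrt ε * n⌉₊ ≤ T.card * 3 := by
      refine Finset.card_mul_le_card_mul (fun q e => q ⊆ e) ?_ ?_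
      · intro q hq
        obtain ⟨u, w, rfl, h1, h2⟩ := (Finset.mem_filter.mp hq).2
        rw [Nat.ceil_le]
        have h1' : ({v, w, u} : Finset (Fin n)) ∈ H := by rwa [Finset.pair_comm w u]
        have e1 := above_bound hH h1 T hT
        have e2 := above_bound hH h1' T hT
        have hc : Nset H w u = Nset H u w := by
          ext z; simp only [Nset, Set.mem_setOf_eq, Finset.insert_comm]
        rw [hc, Finset.pair_comm w u] at e2
        have e1' : ((Nset H v u ∩ Nset H u w).ncard : ℝ) ≤
          ((T.filter fun e => ({u, w} : Finset (Fin n)) ⊆ e).card : ℝ) := by exact_mod_cast e1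
        have e2' : ((Nset H v w ∩ Nset H u w).ncard : ℝ) ≤
          ((T.filter fun e => ({u, w} : Finset (Fin n)) ⊆ e).card : ℝ) := by exact_mod_cast e2
        by_contra hlt
        push Not at hlt
        exact h2 ⟨h1, e1'.trans hlt.le, e2'.trans hlt.le⟩
      · intro e he
        have he3 : e.card = 3 := hH _ (Finset.mem_filter.mp he).2.1
        have : Finset.bipartiteBelow (fun q e => q ⊆ e) B e ⊆ e.powersetCard 2 := by
          intro q hq
          obtain ⟨hqB, hqe⟩ := (Finset.mem_filter.mp hq)
          obtain ⟨u, w, rfl, h1, h2⟩ := (Finset.mem_filter.mp hqB).2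
          exact Finset.mem_powersetCard.mpr
            ⟨hqe, Finset.card_pair (ne_of_triple hH h1).2.2⟩
        refine (Finset.card_le_card this).trans ?_
        rw [Finset.card_powersetCard, he3]
        decide
    have key' : (B.card : ℝ) * (3 * Real.sqrt ε * n) ≤ T.card * 3 := by
      calc (B.card : ℝ) * (3 * Real.sqrt ε * n) ≤ B.card * (⌈3 * Real.sqrt ε * n⌉₊ : ℝ) := by
            gcongr; exact Nat.le_ceil _
        _ ≤ _ := by exact_mod_cast key
    have hp : 0 < 3 * Real.sqrt ε * n := by positivity
    refine le_of_mul_le_mul_right ?_ hp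
    calc _ ≤ (T.card : ℝ) * 3 := key'
      _ ≤ ε * (n : ℝ) ^ 3 * 3 := by linarith
      _ = (Real.sqrt ε * Real.sqrt ε) * (n : ℝ) ^ 3 * 3 := by rw [hss]
      _ = _ := by ring
  · rintro u ⟨w, h1, h2, -⟩
    have hd := hdeg u w (ne_of_triple hH h1).2.2
    have hde : degOn H u w Finset.univ = (Nset H u w).ncard := by
      rw [degOn, ← Set.ncard_coe_finset]
      simp [Nset]
    rw [hde] at hd
    have hu := Set.ncard_union_add_ncard_inter (Nset H v u) (Nset H u w)
    have hle : (Nset H v u ∪ Nset H u w).ncard ≤ n := by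
      simpa using Set.ncard_le_card (Nset H v u ∪ Nset H u w)
    have hu' : ((Nset H v u ∪ Nset H u w).ncard : ℝ) + ((Nset H v u ∩ Nset H u w).ncard : ℝ)
      = (Nset H v u).ncard + (Nset H u w).ncard := by exact_mod_cast hu
    have hle' : ((Nset H v u ∪ Nset H u w).ncard : ℝ) ≤ n := by exact_mod_cast hle
    linarith
end
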